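/- Let G be a countable group that does not have the strong topological Rokhlin property. Then the set of actions α ∈ Act_G(𝒞) that admit a non-sofic symbolic factor — i.e. such that there exist a finite set A with at least two elements and a continuous map φ : 𝒞 → A^G equivariant between α and the shift action whose image φ(𝒞) is a subshift of A^G that is not sofic — is non-meager in Act_G(𝒞). -/

import Mathlib

open Topology

/-- The Cantor space `𝒞`. -/
abbrev Cantor : Type := ℕ → Bool

/-- `α : G → C(𝒞,𝒞)` is a continuous action if it is a homomorphism into the
self-homeomorphisms of `𝒞` (recorded as continuous maps; continuity of the inverse
`α g⁻¹` is automatic from the homomorphism equations). -/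
def IsAction (G : Type) [Group G] (α : G → C(Cantor, Cantor)) : Prop :=
  α 1 = ContinuousMap.id Cantor ∧ ∀ g h : G, α (g * h) = (α g).comp (α h)

/-- The space `Act_G(𝒞)` of continuous actions of `G` on the Cantor space,
topologized as a subspace of `C(𝒞,𝒞)^G` (compact-open topology on each factor). -/
abbrev ActSpace (G : Type) [Group G] : Type :=
  {α : G → C(Cantor, Cantor) // IsAction G α}

/-- The conjugacy class of an action `α` under the conjugation action of `Homeo(𝒞)`. -/
def conjClass {G : Type} [Group G] (α : ActSpace G) : Set (ActSpace G) :=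
  {β | ∃ φ : Cantor ≃ₜ Cantor, ∀ g : G,
    (β.1 g : Cantor → Cantor) = φ ∘ (α.1 g : Cantor → Cantor) ∘ φ.symm}

/-- The strong topological Rokhlin property: some action on the Cantor space has a
comeager conjugacy class. -/
def HasSTRP (G : Type) [Group G] : Prop :=
  ∃ α : ActSpace G, conjClass α ∈ residual (ActSpace G)

/-- The shift action of `G` on `A^G`: `(g • x)(h) = x(g⁻¹h)`. -/
def shift {G : Type} [Group G] {A : Type} (g : G) (x : G → A) : G → A :=
  fun h => x (g⁻¹ * h)

/-- A subshift: closed (in the product of discrete topologies) and shift-invariant. -/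
def IsSubshift (G : Type) [Group G] (A : Type) (X : Set (G → A)) : Prop :=
  (letI : TopologicalSpace A := ⊥; IsClosed X) ∧ ∀ g : G, ∀ x ∈ X, shift g x ∈ X

/-- The set `X_F` of `F`-patterns of `X`. -/
def patterns {G A : Type} (F : Finset G) (X : Set (G → A)) : Set (F → A) :=
  (fun (x : G → A) (f : F) => x (f : G)) '' X

/-- Subshift of finite type, with defining window `E` and allowed patterns `𝔽`. -/
def IsSFT (G : Type) [Group G] (A : Type) (X : Set (G → A)) : Prop :=
  ∃ (E : Finset G) (𝔽 : Set (E → A)),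
    ∀ x : G → A, x ∈ X ↔ ∀ g : G, (fun e : E => shift g x (e : G)) ∈ 𝔽

/-- Continuity on a set, for a map between full shift spaces over discrete alphabets. -/
def ContinuousOnD {G A B : Type} (ψ : (G → B) → (G → A)) (Z : Set (G → B)) : Prop :=
  letI : TopologicalSpace A := ⊥
  letI : TopologicalSpace B := ⊥
  ContinuousOn ψ Z

/-- `G`-equivariance of a map between shift spaces, on a set. -/
def EquivariantOn {G A B : Type} [Group G] (ψ : (G → B) → (G → A)) (Z : Set (G → B)) : Prop :=
  ∀ g : G, ∀ z ∈ Z, ψ (shift g z) = shift g (ψ z)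

/-- A sofic subshift: a continuous `G`-equivariant image of a subshift of finite type. -/
def IsSofic (G : Type) [Group G] (A : Type) (X : Set (G → A)) : Prop :=
  ∃ (B : Type) (_ : Fintype B) (_ : Nontrivial B) (Z : Set (G → B))
    (ψ : (G → B) → (G → A)),
    IsSubshift G B Z ∧ IsSFT G B Z ∧ ContinuousOnD ψ Z ∧ EquivariantOn ψ Z ∧ ψ '' Z = X

/-- The sliding block code `Φ(y)(g) = f(d ↦ y(g·d))` induced by `f : (D → B) → A`. -/
def slidingBlock {G : Type} [Group G] {A B : Type} (D : Finset G)
    (f : (D → B) → A) : (G → B) → (G → A) :=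
  fun y g => f (fun d => y (g * (d : G)))

/-- A projectively isolated subshift. -/
def ProjIsolated (G : Type) [Group G] (A : Type) (X : Set (G → A)) : Prop :=
  ∃ (B : Type) (_ : Fintype B) (_ : Nontrivial B) (Y : Set (G → B))
    (F D : Finset G) (f : (D → B) → A),
    IsSubshift G B Y ∧
    slidingBlock D f '' Y = X ∧
    ∀ Z : Set (G → B), IsSubshift G B Z → patterns F Z = patterns F Y →
      slidingBlock D f '' Z = X

/-- An isolated subshift: an SFT `X` such that for some finite `F ⊆ G` no proper
subshift has the same `F`-patterns as `X`. -/
def IsIsolated (G : Type) [Group G] (A : Type) (X : Set (G → A)) : Prop :=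
  IsSFT G A X ∧ ∃ F : Finset G, ∀ Y : Set (G → A),
    IsSubshift G A Y → Y ⊂ X → patterns F Y ≠ patterns F X

/-- A strongly projectively isolated subshift: a continuous `G`-equivariant image of an
isolated subshift. -/
def StronglyProjIsolated (G : Type) [Group G] (A : Type) (X : Set (G → A)) : Prop :=
  ∃ (B : Type) (_ : Fintype B) (_ : Nontrivial B) (Y : Set (G → B))
    (ψ : (G → B) → (G → A)),
    IsSubshift G B Y ∧ IsIsolated G B Y ∧
    ContinuousOnD ψ Y ∧ EquivariantOn ψ Y ∧ ψ '' Y = X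

/-- Shadowing (the pseudo-orbit tracing property) of an action `act` of `G`,
with respect to a distance function `d`. -/
def HasShadowing {G X : Type} [Group G] (d : X → X → ℝ) (act : G → X → X) : Prop :=
  ∀ ε : ℝ, 0 < ε → ∃ (δ : ℝ) (S : Finset G), 0 < δ ∧
    ∀ x : G → X, (∀ g : G, ∀ s ∈ S, d (act s (x g)) (x (s * g)) < δ) →
      ∃ y : X, ∀ g : G, d (x g) (act g y) < ε

/-- A finite partition of the whole space into nonempty clopen sets. -/
def IsClopenPartition {X : Type} [TopologicalSpace X] (parts : Finset (Set X)) : Prop :=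
  (∀ P ∈ parts, IsClopen P ∧ P.Nonempty) ∧
  (∀ P ∈ parts, ∀ Q ∈ parts, P ≠ Q → Disjoint P Q) ∧
  (⋃ P ∈ parts, P) = Set.univ

/-- A finite partition of a subshift `X` into nonempty subsets that are clopen in `X`. -/
def IsClopenPartitionIn {G A : Type} (X : Set (G → A)) (parts : Finset (Set (G → A))) : Prop :=
  (letI : TopologicalSpace A := ⊥;
    ∀ P ∈ parts, P.Nonempty ∧ P ⊆ X ∧ IsClopen (Subtype.val ⁻¹' P : Set X)) ∧
  (∀ P ∈ parts, ∀ Q ∈ parts, P ≠ Q → Disjoint P Q) ∧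
  (⋃ P ∈ parts, P) = X

/-- `X` is `fam`-minimal: no nonempty proper subshift of `X` meets every member of `fam`. -/
def AMinimal {G A : Type} [Group G] (X : Set (G → A)) (fam : Set (Set (G → A))) : Prop :=
  ¬ ∃ Y : Set (G → A), IsSubshift G A Y ∧ Y.Nonempty ∧ Y ⊂ X ∧
    ∀ S ∈ fam, (Y ∩ S).Nonempty

/-- The free product of a subshift `V ⊆ B^G` and a subshift `W ⊆ B^H`, a subshift
of `B^(G∗H)`. -/
def freeProd {G H B : Type} [Group G] [Group H]
    (V : Set (G → B)) (W : Set (H → B)) : Set (Monoid.Coprod G H → B) :=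
  {x | ∀ g : Monoid.Coprod G H,
    (fun h : G => x (g * Monoid.Coprod.inl h)) ∈ V ∧
    (fun k : H => x (g * Monoid.Coprod.inr k)) ∈ W}

/-- Continuity of a map into a finite (discrete) alphabet. -/
def ContinuousToDiscrete {X A : Type} [TopologicalSpace X] (c : X → A) : Prop :=
  letI : TopologicalSpace A := ⊥
  Continuous c

/-- Continuity of a map into the shift space `A^G` over a discrete alphabet `A`. -/
def ContinuousIntoShift {X G A : Type} [TopologicalSpace X] (φ : X → (G → A)) : Prop :=
  letI : TopologicalSpace A := ⊥
  Continuous φ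

/-! ### Colourings and itineraries -/

/-- The set of itineraries of a colouring `c` under the maps `act g`. -/
def itineraries {G K : Type} (act : G → K → K) (c : K → ℕ) : Set (G → ℕ) :=
  Set.range fun (x : K) (g : G) => c (act g x)

/-- The common refinement of two colourings. -/
def pairColor {K : Type} [TopologicalSpace K] (c d : C(K, ℕ)) : C(K, ℕ) :=
  ⟨fun x => Nat.pair (c x) (d x),
    (continuous_of_discreteTopology (f := fun p : ℕ × ℕ => Nat.pair p.1 p.2)).comp
      (c.continuous.prodMk d.continuous)⟩

@[simp]
theorem pairColor_apply {K : Type} [TopologicalSpace K] (c d : C(K, ℕ)) (x : K) :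
    pairColor c d x = Nat.pair (c x) (d x) := rfl

theorem pairColor_eq_iff {K L : Type} [TopologicalSpace K] [TopologicalSpace L]
    (c d : C(K, ℕ)) (c' d' : C(L, ℕ)) (x : K) (y : L) :
    pairColor c d x = pairColor c' d' y ↔ c x = c' y ∧ d x = d' y := by
  simp [Nat.pair_eq_pair]

theorem countable_continuousMap_nat (K : Type) [TopologicalSpace K] [CompactSpace K]
    [T2Space K] [SecondCountableTopology K] : Countable C(K, ℕ) := by
  have hfin : ∀ f : C(K, ℕ), (Set.range f).Finite := fun f =>
    (isCompact_range f.continuous).finite_of_discrete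
  have : DiscreteTopology C(K, ℕ) := by
    rw [discreteTopology_iff_isOpen_singleton]
    intro f
    have h : ({f} : Set C(K, ℕ)) =
        ⋂ n ∈ Set.range f, {g : C(K, ℕ) | Set.MapsTo g (f ⁻¹' {n}) {n}} := by
      ext g
      simp only [Set.mem_singleton_iff, Set.mem_iInter, Set.mem_ofPred_eq]
      constructor
      · rintro rfl n _ x hx
        exact hx
      · intro h
        ext x
        exact h (f x) ⟨x, rfl⟩ rfl
    rw [h]
    refine (hfin f).isOpen_biInter fun n _ => ?_
    exact ContinuousMap.isOpen_setOfPred_mapsTo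
      ((isClosed_singleton.preimage f.continuous).isCompact) (isOpen_discrete _)
  exact TopologicalSpace.separableSpace_iff_countable.1 inferInstance

theorem exists_separating_sequence (K : Type) [TopologicalSpace K] [CompactSpace K] [T2Space K]
    [SecondCountableTopology K] [TotallyDisconnectedSpace K] :
    ∃ u : ℕ → C(K, ℕ), ∀ x y, (∀ k, u k x = u k y) → x = y := by
  classical
  have := countable_continuousMap_nat K
  obtain ⟨u, hu⟩ := exists_surjective_nat C(K, ℕ)
  refine ⟨u, fun x y h => ?_⟩
  by_contra hxy
  obtain ⟨U, hU, hx, hy⟩ := exists_isClopen_of_totally_separated hxy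
  let f : C(K, ℕ) := ⟨fun z => if z ∈ U then 1 else 0, by
    refine continuous_const.if ?_ continuous_const
    intro a ha
    have hfr : frontier U = ∅ := hU.frontier_eq
    change a ∈ frontier U at ha
    simp [hfr] at ha⟩
  obtain ⟨k, hk⟩ := hu f
  have := h k
  rw [hk] at this
  have hy' : y ∉ U := hy
  simp [f, hx, hy'] at this

/-- Points of two systems whose itineraries match for every colouring in a sequence,
provided the itinerary sets agree and the sequence is increasingly fine. -/
theorem exists_matching_point {G K L : Type} [TopologicalSpace K] [TopologicalSpace L] [CompactSpace L]
    {act : G → K → K} {act' : G → L → L} (hact' : ∀ g, Continuous (act' g))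
    (c : ℕ → C(K, ℕ)) (d : ℕ → C(L, ℕ))
    (hcd : ∀ k, itineraries act (c k) = itineraries act' (d k))
    (hmono : ∀ k x y, c (k + 1) x = d (k + 1) y → c k x = d k y) (x : K) :
    ∃ y, ∀ k g, c k (act g x) = d k (act' g y) := by
  let Y : ℕ → Set L := fun k => {y | ∀ g, c k (act g x) = d k (act' g y)}
  have hclosed : ∀ k, IsClosed (Y k) := fun k => by
    simp only [Y, Set.ofPred_forall]
    exact isClosed_iInter fun g =>
      isClosed_eq continuous_const ((d k).continuous.comp (hact' g))
  obtain ⟨y, hy⟩ := IsCompact.nonempty_iInter_of_sequence_nonempty_isCompact_isClosed Y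
    (fun k y hy g => hmono k _ _ (hy g))
    (fun k => by
      have : (fun g => c k (act g x)) ∈ itineraries act' (d k) := hcd k ▸ ⟨x, rfl⟩
      obtain ⟨y, hy⟩ := this
      exact ⟨y, fun g => (congrFun hy g).symm⟩)
    (hclosed 0).isCompact hclosed
  exact ⟨y, fun k g => Set.mem_iInter.1 hy k g⟩

/-- Back-and-forth: if itinerary-preserving pairs of colourings can be refined on either
side, then any such pair comes from an equivariant homeomorphism. -/
theorem exists_homeomorph_of_back_and_forth {G K L : Type} [One G]
    [TopologicalSpace K] [CompactSpace K] [T2Space K] [SecondCountableTopology K]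
    [TotallyDisconnectedSpace K]
    [TopologicalSpace L] [CompactSpace L] [T2Space L] [SecondCountableTopology L]
    [TotallyDisconnectedSpace L]
    {act : G → K → K} {act' : G → L → L}
    (hact : ∀ g, Continuous (act g)) (hact' : ∀ g, Continuous (act' g))
    (hone : ∀ x, act 1 x = x) (hone' : ∀ y, act' 1 y = y)
    (forth : ∀ (c : C(K, ℕ)) (d : C(L, ℕ)), itineraries act c = itineraries act' d →
      ∀ a, ∃ b, itineraries act (pairColor c a) = itineraries act' (pairColor d b))
    (back : ∀ (c : C(K, ℕ)) (d : C(L, ℕ)), itineraries act c = itineraries act' d →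
      ∀ b, ∃ a, itineraries act (pairColor c a) = itineraries act' (pairColor d b))
    (c₀ : C(K, ℕ)) (d₀ : C(L, ℕ)) (h₀ : itineraries act c₀ = itineraries act' d₀) :
    ∃ φ : K ≃ₜ L, (∀ x, d₀ (φ x) = c₀ x) ∧ ∀ g x, φ (act g x) = act' g (φ x) := by
  obtain ⟨u, hu⟩ := exists_separating_sequence K
  obtain ⟨v, hv⟩ := exists_separating_sequence L
  let S := {p : C(K, ℕ) × C(L, ℕ) // itineraries act p.1 = itineraries act' p.2}
  have step : ∀ (k : ℕ) (p : S), ∃ q : S, ∃ a b,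
      q.1.1 = pairColor (pairColor p.1.1 (u k)) a ∧
      q.1.2 = pairColor (pairColor p.1.2 b) (v k) := by
    rintro k ⟨⟨c, d⟩, h⟩
    obtain ⟨b, hb⟩ := forth c d h (u k)
    obtain ⟨a, ha⟩ := back _ _ hb (v k)
    exact ⟨⟨(_, _), ha⟩, a, b, rfl, rfl⟩
  choose succ a b hsucc₁ hsucc₂ using step
  let s : ℕ → S := fun k => Nat.rec ⟨(c₀, d₀), h₀⟩ (fun k p => succ k p) k
  have hs₁ : ∀ k, (s (k + 1)).1.1 = pairColor (pairColor (s k).1.1 (u k)) (a k (s k)) :=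
    fun k => hsucc₁ k (s k)
  have hs₂ : ∀ k, (s (k + 1)).1.2 = pairColor (pairColor (s k).1.2 (b k (s k))) (v k) :=
    fun k => hsucc₂ k (s k)
  let c : ℕ → C(K, ℕ) := fun k => (s k).1.1
  let d : ℕ → C(L, ℕ) := fun k => (s k).1.2
  have hc : ∀ k x x', c (k + 1) x = c (k + 1) x' → u k x = u k x' := by
    intro k x x' h
    simp only [c, hs₁, pairColor_eq_iff] at h
    exact h.1.2
  have hd : ∀ k y y', d (k + 1) y = d (k + 1) y' → v k y = v k y' := by
    intro k x x' h
    simp only [d, hs₂, pairColor_eq_iff] at h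
    exact h.2
  have hmono : ∀ k x y, c (k + 1) x = d (k + 1) y → c k x = d k y := by
    intro k x y h
    simp only [c, d, hs₁, hs₂, pairColor_eq_iff] at h
    exact h.1.1
  have hcd : ∀ k, itineraries act (c k) = itineraries act' (d k) := fun k => (s k).2
  have hcinj : ∀ x x', (∀ k, c k x = c k x') → x = x' :=
    fun x x' h => hu x x' fun k => hc k x x' (h (k + 1))
  have hdinj : ∀ y y', (∀ k, d k y = d k y') → y = y' :=
    fun y y' h => hv y y' fun k => hd k y y' (h (k + 1))
  choose φ hφ using exists_matching_point hact' c d hcd hmono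
  choose ψ hψ using exists_matching_point hact d c (fun k => (hcd k).symm)
    (fun k y x h => (hmono k x y h.symm).symm)
  have hφ1 : ∀ x k, c k x = d k (φ x) := fun x k => by simpa [hone, hone'] using hφ x k 1
  have hψ1 : ∀ y k, d k y = c k (ψ y) := fun y k => by simpa [hone, hone'] using hψ y k 1
  let e : K ≃ L :=
    { toFun := φ
      invFun := ψ
      left_inv := fun x => hcinj _ _ fun k => by rw [← hψ1, ← hφ1]
      right_inv := fun y => hdinj _ _ fun k => by rw [← hφ1, ← hψ1] }
  have hcont : Continuous φ := by
    have hemb : IsClosedEmbedding fun (y : L) k => d k y :=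
      Continuous.isClosedEmbedding (continuous_pi fun k => (d k).continuous)
        fun y y' h => hdinj y y' (congrFun h)
    refine hemb.isInducing.continuous_iff.2 (continuous_pi fun k => ?_)
    exact (c k).continuous.congr fun x => hφ1 x k
  refine ⟨hcont.homeoOfEquivCompactToT2 (f := e), fun x => (hφ1 x 0).symm, fun g x => ?_⟩
  exact hdinj _ _ fun k => by
    change d k (φ (act g x)) = d k (act' g (φ x))
    rw [← hφ1, hφ]

/-- Every nonempty open set can be coloured onto every nonempty finite set of colours. -/
def RichlyColorable (K : Type) [TopologicalSpace K] : Prop :=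
  ∀ U : Set K, IsOpen U → U.Nonempty → ∀ S : Set ℕ, S.Finite → S.Nonempty →
    ∃ f : C(K, ℕ), Set.range f ⊆ S ∧ S ⊆ f '' U

theorem RichlyColorable.exists_refinement {K L : Type}
    [TopologicalSpace K] [CompactSpace K] [TopologicalSpace L] (hL : RichlyColorable L)
    (c : C(K, ℕ)) (d : C(L, ℕ)) (h : Set.range c = Set.range d) (a : C(K, ℕ)) :
    ∃ b : C(L, ℕ), Set.range (pairColor c a) = Set.range (pairColor d b) := by
  have key : ∀ n, ∃ f : C(L, ℕ), f '' (d ⁻¹' {n}) = a '' (c ⁻¹' {n}) := by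
    intro n
    by_cases hn : n ∈ Set.range c
    · have hd : (d ⁻¹' {n}).Nonempty := by
        obtain ⟨y, hy⟩ := h ▸ hn
        exact ⟨y, hy⟩
      have ha : (a '' (c ⁻¹' {n})).Nonempty := by
        obtain ⟨x, hx⟩ := hn
        exact ⟨a x, x, hx, rfl⟩
      obtain ⟨f, hf, hf'⟩ := hL _ ((isOpen_discrete {n}).preimage d.continuous) hd _
        (((isCompact_range a.continuous).finite_of_discrete).subset
          (Set.image_subset_range _ _)) ha
      exact ⟨f, ((Set.image_subset_range _ _).trans hf).antisymm hf'⟩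
    · refine ⟨0, ?_⟩
      have h1 : c ⁻¹' {n} = ∅ := by
        ext x; simp; rintro rfl; exact hn ⟨x, rfl⟩
      have h2 : d ⁻¹' {n} = ∅ := by
        ext x; simp; rintro rfl; exact hn (h ▸ ⟨x, rfl⟩)
      rw [h1, h2]; simp
  choose f hf using key
  have hF : Continuous fun p : ℕ × L => f p.1 p.2 :=
    continuous_prod_of_discrete_left.2 fun n => (f n).continuous
  let b : C(L, ℕ) := ⟨fun y => f (d y) y, hF.comp (d.continuous.prodMk continuous_id)⟩
  refine ⟨b, Set.Subset.antisymm ?_ ?_⟩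
  · rintro _ ⟨x, rfl⟩
    have : a x ∈ f (c x) '' (d ⁻¹' {c x}) := hf (c x) ▸ ⟨x, rfl, rfl⟩
    obtain ⟨y, hy, hy'⟩ := this
    refine ⟨y, (pairColor_eq_iff _ _ _ _ _ _).2 ⟨hy, ?_⟩⟩
    change d y = c x at hy
    change f (d y) y = a x
    rw [hy, hy']
  · rintro _ ⟨y, rfl⟩
    have : f (d y) y ∈ a '' (c ⁻¹' {d y}) := hf (d y) ▸ ⟨y, rfl, rfl⟩
    obtain ⟨x, hx, hx'⟩ := this
    exact ⟨x, (pairColor_eq_iff _ _ _ _ _ _).2 ⟨hx, hx'⟩⟩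

/-- Colourings with the same set of colours differ by a homeomorphism. -/
theorem exists_homeomorph_of_range_eq {K L : Type}
    [TopologicalSpace K] [CompactSpace K] [T2Space K] [SecondCountableTopology K]
    [TotallyDisconnectedSpace K]
    [TopologicalSpace L] [CompactSpace L] [T2Space L] [SecondCountableTopology L]
    [TotallyDisconnectedSpace L] (hK : RichlyColorable K) (hL : RichlyColorable L)
    (c : C(K, ℕ)) (d : C(L, ℕ)) (h : Set.range c = Set.range d) :
    ∃ φ : K ≃ₜ L, ∀ x, d (φ x) = c x := by
  have key : ∀ (c : C(K, ℕ)) (d : C(L, ℕ)),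
      itineraries (fun (_ : Unit) (x : K) => x) c = itineraries (fun (_ : Unit) (y : L) => y) d ↔
        Set.range c = Set.range d := by
    have hrange : ∀ {M : Type} (f : M → ℕ), itineraries (fun (_ : Unit) (x : M) => x) f =
        (fun n _ => n) '' Set.range f := fun f => by
      rw [← Set.range_comp]; rfl
    intro c d
    rw [hrange, hrange]
    exact (Set.image_injective.2 fun m n hmn => congrFun hmn ()).eq_iff
  obtain ⟨φ, hφ, -⟩ := exists_homeomorph_of_back_and_forth (G := Unit)
    (act := fun _ (x : K) => x) (act' := fun _ (y : L) => y)
    (fun _ => continuous_id) (fun _ => continuous_id) (fun _ => rfl) (fun _ => rfl)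
    (fun c d h a => by
      simp only [key] at h ⊢
      exact hL.exists_refinement c d h a)
    (fun c d h b => by
      simp only [key] at h ⊢
      obtain ⟨a, ha⟩ := hK.exists_refinement d c h.symm b
      exact ⟨a, ha.symm⟩)
    c d ((key c d).2 h)
  exact ⟨φ, hφ⟩

theorem richlyColorable_cantor : RichlyColorable Cantor := by
  classical
  rintro U hU ⟨x, hx⟩ S hS ⟨s₁, hs₁⟩
  have := hS.to_subtype
  have : Nonempty S := ⟨⟨s₁, hs₁⟩⟩
  obtain ⟨I, u, hu, hIU⟩ := isOpen_pi_iff.1 hU x hx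
  obtain ⟨N, hN⟩ : ∃ N, ∀ i ∈ I, i < N :=
    ⟨I.sup id + 1, fun i hi => Nat.lt_succ_of_le (Finset.le_sup (f := id) hi)⟩
  let code : S → S → Bool := fun s t => decide (t = s)
  have hcode : Function.Injective code := fun s t h => by
    have := congrFun h s
    simpa [code] using this
  let f : C(Cantor, ℕ) := ⟨fun z => (Function.invFun code fun s : S => z (N + s) : S), by
    refine (continuous_of_discreteTopology
      (f := fun w : S → Bool => ((Function.invFun code w : S) : ℕ))).comp ?_
    exact continuous_pi fun s => continuous_apply _⟩
  refine ⟨f, ?_, fun s hs => ?_⟩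
  · rintro _ ⟨z, rfl⟩
    exact Subtype.coe_prop _
  · refine ⟨fun i => if i < N then x i else decide (i = N + s), hIU fun i hi => ?_, ?_⟩
    · simp only [hN i hi, if_true]
      exact (hu i hi).2
    · have : (fun t : S => if N + (t : ℕ) < N then x (N + t) else decide (N + (t : ℕ) = N + s)) =
          code ⟨s, hs⟩ := by
        funext t
        simp [code, Subtype.ext_iff]
      change ((Function.invFun code fun t : S => if N + (t : ℕ) < N then x (N + t)
        else decide (N + (t : ℕ) = N + s) : S) : ℕ) = s
      rw [this, Function.leftInverse_invFun hcode]

theorem RichlyColorable.prod {K L : Type} [TopologicalSpace K] [TopologicalSpace L]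
    (hL : RichlyColorable L) : RichlyColorable (K × L) := by
  rintro U hU ⟨⟨x, y⟩, hxy⟩ S hS hS'
  obtain ⟨f, hf, hf'⟩ := hL {z | (x, z) ∈ U} (hU.preimage (by fun_prop)) ⟨y, hxy⟩ S hS hS'
  refine ⟨f.comp ⟨Prod.snd, continuous_snd⟩, ?_, fun s hs => ?_⟩
  · rintro _ ⟨p, rfl⟩
    exact hf ⟨p.2, rfl⟩
  · obtain ⟨z, hz, rfl⟩ := hf' hs
    exact ⟨(x, z), hz, rfl⟩

/-! ### The space of actions -/

instance (G : Type) [Group G] [Countable G] : BaireSpace (ActSpace G) := by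
  have hclosed : IsClosed {α : G → C(Cantor, Cantor) | IsAction G α} := by
    have hmul : IsClosed {α : G → C(Cantor, Cantor) | ∀ g h, α (g * h) = (α g).comp (α h)} := by
      simp only [Set.ofPred_forall]
      exact isClosed_iInter fun g => isClosed_iInter fun h =>
        isClosed_eq (continuous_apply _) ((continuous_apply g).compCM (continuous_apply h))
    exact IsClosed.inter (isClosed_eq (continuous_apply 1) continuous_const) hmul
  have : CompleteSpace (ActSpace G) := hclosed.completeSpace_coe
  have : (uniformity Bool).IsCountablyGenerated := by
    rw [DiscreteUniformity.eq_principal_setRelId]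
    infer_instance
  have : (uniformity (ActSpace G)).IsCountablyGenerated := by
    rw [uniformity_subtype]
    infer_instance
  have : TopologicalSpace.IsCompletelyPseudoMetrizableSpace (ActSpace G) := inferInstance
  infer_instance

/-- The itineraries of a colouring `c` under an action `α` on the Cantor space. -/
def codes {G : Type} [Group G] (α : ActSpace G) (c : Cantor → ℕ) : Set (G → ℕ) :=
  itineraries (fun g => α.1 g) c

section

variable {G : Type} [Group G]

theorem ActSpace.one_apply (α : ActSpace G) (x : Cantor) : α.1 1 x = x := by
  rw [α.2.1]; rfl

/-- An action on a space homeomorphic to the Cantor space, viewed on the Cantor space. -/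
def transportAct {K : Type} [TopologicalSpace K] (φ : K ≃ₜ Cantor) (act : G → C(K, K))
    (hone : ∀ x, act 1 x = x) (hmul : ∀ g h x, act (g * h) x = act g (act h x)) : ActSpace G :=
  ⟨fun g => (ContinuousMap.comp ⟨φ, φ.continuous⟩ (act g)).comp ⟨φ.symm, φ.symm.continuous⟩, by
    refine ⟨?_, fun g h => ?_⟩
    · ext1 x
      simp [hone]
    · ext1 x
      simp [hmul]⟩

/-- The conjugate `ψ⁻¹ β ψ`. -/
def conjAct (ψ : Cantor ≃ₜ Cantor) (β : ActSpace G) : ActSpace G :=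
  transportAct ψ.symm β.1 β.one_apply fun g h x => by rw [β.2.2]; rfl

theorem conjAct_apply (ψ : Cantor ≃ₜ Cantor) (β : ActSpace G) (g : G) (x : Cantor) :
    ψ ((conjAct ψ β).1 g x) = β.1 g (ψ x) := by
  simp [conjAct, transportAct]

theorem continuous_conjAct (ψ : Cantor ≃ₜ Cantor) :
    Continuous (conjAct ψ : ActSpace G → ActSpace G) := by
  refine Continuous.subtype_mk (continuous_pi fun g => ?_) _
  exact (continuous_const.compCM ((continuous_apply g).comp continuous_subtype_val)).compCM
    continuous_const

theorem codes_comp {α γ : ActSpace G} {π : Cantor → Cantor} (hπ : Function.Surjective π)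
    (h : ∀ g x, π (γ.1 g x) = α.1 g (π x)) (c : Cantor → ℕ) :
    codes γ (c ∘ π) = codes α c := by
  apply Set.Subset.antisymm
  · rintro _ ⟨x, rfl⟩
    exact ⟨π x, by simp [h]⟩
  · rintro _ ⟨y, rfl⟩
    obtain ⟨x, rfl⟩ := hπ y
    exact ⟨x, by simp [h]⟩

theorem codes_conjAct (ψ : Cantor ≃ₜ Cantor) (β : ActSpace G) (c : Cantor → ℕ) :
    codes (conjAct ψ β) (c ∘ ψ) = codes β c :=
  codes_comp ψ.surjective (conjAct_apply ψ β) c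

theorem continuous_action_eval (g : G) :
    Continuous fun p : ActSpace G × Cantor => p.1.1 g p.2 :=
  continuous_eval.comp
    (((continuous_apply g).comp (continuous_subtype_val.comp continuous_fst)).prodMk
      continuous_snd)

theorem isCompact_codes (α : ActSpace G) (c : C(Cantor, ℕ)) : IsCompact (codes α c) :=
  isCompact_range (continuous_pi fun g => c.continuous.comp (α.1 g).continuous)

theorem isClosed_setOf_codes_eq (c : C(Cantor, ℕ)) (X : Set (G → ℕ)) :
    IsClosed {α : ActSpace G | codes α c = X} := by
  by_cases hX : ∃ α : ActSpace G, codes α c = X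
  · obtain ⟨α, rfl⟩ := hX
    set X := codes α c
    have hXc : IsClosed X := (isCompact_codes α c).isClosed
    have h1 : IsClosed {β : ActSpace G | codes β c ⊆ X} := by
      have : {β : ActSpace G | codes β c ⊆ X} =
          ⋂ z : Cantor, {β : ActSpace G | (fun g => c (β.1 g z)) ∈ X} := by
        ext β
        simp [codes, itineraries, Set.range_subset_iff]
      rw [this]
      exact isClosed_iInter fun z => hXc.preimage (continuous_pi fun g =>
        c.continuous.comp ((continuous_action_eval g).comp
          (continuous_id.prodMk continuous_const)))
    have h2 : IsClosed {β : ActSpace G | X ⊆ codes β c} := by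
      have : {β : ActSpace G | X ⊆ codes β c} =
          ⋂ x ∈ X, Prod.fst '' {p : ActSpace G × Cantor | ∀ g, c (p.1.1 g p.2) = x g} := by
        ext β
        simp [Set.subset_def, codes, itineraries, funext_iff]
      rw [this]
      refine isClosed_biInter fun x _ => isClosedMap_fst_of_compactSpace _ ?_
      simp only [Set.ofPred_forall]
      exact isClosed_iInter fun g =>
        isClosed_eq (c.continuous.comp (continuous_action_eval g)) continuous_const
    convert h1.inter h2 using 1
    ext β
    exact Set.Subset.antisymm_iff
  · convert isClosed_empty
    ext β
    simpa using fun h => hX ⟨β, h⟩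

/-- Neighbourhoods of an action are detected by the itineraries of a single colouring. -/
theorem exists_color_of_mem_nhds (β : ActSpace G) {U : Set (ActSpace G)} (hU : U ∈ 𝓝 β) :
    ∃ e : C(Cantor, ℕ), ∀ γ, codes γ e = codes β e → γ ∈ U := by
  classical
  let ℱ : Filter (ActSpace G) :=
    { sets := {U | ∃ e : C(Cantor, ℕ), ∀ γ, codes γ e = codes β e → γ ∈ U}
      univ_sets := ⟨0, fun _ _ => trivial⟩
      sets_of_superset := fun ⟨e, he⟩ h => ⟨e, fun γ hγ => h (he γ hγ)⟩
      inter_sets := by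
        rintro U V ⟨e, he⟩ ⟨f, hf⟩
        have key : ∀ (γ : ActSpace G) (p : ℕ → ℕ),
            codes γ (p ∘ pairColor e f) = (fun x => p ∘ x) '' codes γ (pairColor e f) := by
          intro γ p
          rw [codes, codes, itineraries, itineraries, ← Set.range_comp]
          rfl
        have h1 : (fun n => (Nat.unpair n).1) ∘ pairColor e f = e := by ext; simp
        have h2 : (fun n => (Nat.unpair n).2) ∘ pairColor e f = f := by ext; simp
        refine ⟨pairColor e f, fun γ hγ => ⟨he γ ?_, hf γ ?_⟩⟩
        · rw [← h1, key, key, hγ]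
        · rw [← h2, key, key, hγ] }
  suffices h : ℱ ≤ 𝓝 β from h hU
  rw [nhds_subtype_eq_comap, nhds_pi, Filter.pi, ← Filter.tendsto_iff_comap, Filter.tendsto_iInf]
  intro g
  rw [Filter.tendsto_comap_iff, ContinuousMap.nhds_compactOpen]
  simp only [Filter.tendsto_iInf, Filter.tendsto_principal]
  intro K hK V hV hKV
  obtain ⟨C, hC, hKC, hCV⟩ := exists_clopen_of_closed_subset_open
    (hK.image (β.1 g).continuous).isClosed hV hKV.image_subset
  let χ : C(Cantor, ℕ) := ⟨fun z => if z ∈ C then 1 else 0, by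
    refine continuous_const.if ?_ continuous_const
    intro a ha
    have hfr : frontier C = ∅ := hC.frontier_eq
    change a ∈ frontier C at ha
    simp [hfr] at ha⟩
  have hχ : ∀ z, χ z = 1 ↔ z ∈ C := fun z => by
    change (if z ∈ C then 1 else 0) = 1 ↔ _
    simp
  refine ⟨pairColor χ (χ.comp (β.1 g)), fun γ hγ x hx => hCV ?_⟩
  have hx' : (fun h => pairColor χ (χ.comp (β.1 g)) (γ.1 h x)) ∈
      codes β (pairColor χ (χ.comp (β.1 g))) := hγ ▸ ⟨x, rfl⟩
  obtain ⟨y, hy⟩ := hx'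
  have hy1 := (pairColor_eq_iff _ _ _ _ _ _).1 (congrFun hy 1)
  have hyg := (pairColor_eq_iff _ _ _ _ _ _).1 (congrFun hy g)
  simp only [ActSpace.one_apply, ContinuousMap.comp_apply] at hy1 hyg
  change γ.1 g x ∈ C
  rw [← hχ, ← hyg.1, hy1.2, hχ]
  exact hKC ⟨x, hx, rfl⟩

/-- Two actions with a common coded factor have a common extension, which may be chosen to
have the second action as a factor by a map preserving a given colouring. -/
theorem exists_joint_extension (α β : ActSpace G) (c d b : C(Cantor, ℕ))
    (h : codes α c = codes β d) :
    ∃ (γ : ActSpace G) (π₁ π₂ : C(Cantor, Cantor)),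
      Function.Surjective π₁ ∧ Function.Surjective π₂ ∧
      (∀ g x, π₁ (γ.1 g x) = α.1 g (π₁ x)) ∧ (∀ g x, π₂ (γ.1 g x) = β.1 g (π₂ x)) ∧
      (∀ x, c (π₁ x) = d (π₂ x)) ∧ ∀ x, b (π₂ x) = b x := by
  let L : Set (Cantor × Cantor) := {p | ∀ g, c (α.1 g p.1) = d (β.1 g p.2)}
  have hL : IsClosed L := by
    simp only [L, Set.ofPred_forall]
    exact isClosed_iInter fun g => isClosed_eq (by fun_prop) (by fun_prop)
  have : CompactSpace L := isCompact_iff_compactSpace.1 hL.isCompact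
  have hstable : ∀ g, ∀ p ∈ L, (α.1 g p.1, β.1 g p.2) ∈ L := fun g p hp k => by
    have := hp (k * g)
    rw [α.2.2, β.2.2] at this
    exact this
  have hsurj₁ : ∀ x, ∃ p ∈ L, p.1 = x := fun x => by
    have hx : (fun g => c (α.1 g x)) ∈ codes β d := h ▸ ⟨x, rfl⟩
    obtain ⟨y, hy⟩ := hx
    exact ⟨(x, y), fun g => (congrFun hy g).symm, rfl⟩
  have hsurj₂ : ∀ y, ∃ p ∈ L, p.2 = y := fun y => by
    have hy : (fun g => d (β.1 g y)) ∈ codes α c := h ▸ ⟨y, rfl⟩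
    obtain ⟨x, hx⟩ := hy
    exact ⟨(x, y), fun g => congrFun hx g, rfl⟩
  let act : G → C(L × Cantor, L × Cantor) := fun g =>
    ⟨fun q => (⟨(α.1 g q.1.1.1, β.1 g q.1.1.2), hstable g _ q.1.2⟩, q.2), by fun_prop⟩
  let pr₁ : C(L × Cantor, Cantor) := ⟨fun q => q.1.1.1, by fun_prop⟩
  let pr₂ : C(L × Cantor, Cantor) := ⟨fun q => q.1.1.2, by fun_prop⟩
  have hpr₁ : Function.Surjective pr₁ := fun x => by
    obtain ⟨p, hp, rfl⟩ := hsurj₁ x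
    exact ⟨(⟨p, hp⟩, p.1), rfl⟩
  have hpr₂ : Function.Surjective pr₂ := fun y => by
    obtain ⟨p, hp, rfl⟩ := hsurj₂ y
    exact ⟨(⟨p, hp⟩, p.1), rfl⟩
  obtain ⟨φ, hφ⟩ := exists_homeomorph_of_range_eq (K := L × Cantor)
    richlyColorable_cantor.prod richlyColorable_cantor (b.comp pr₂) b
    (hpr₂.range_comp b)
  refine ⟨transportAct φ act ?_ ?_, pr₁.comp ⟨φ.symm, φ.symm.continuous⟩,
    pr₂.comp ⟨φ.symm, φ.symm.continuous⟩, hpr₁.comp φ.symm.surjective,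
    hpr₂.comp φ.symm.surjective, fun g x => ?_, fun g x => ?_, fun x => ?_, fun x => ?_⟩
  · rintro ⟨⟨p, hp⟩, z⟩
    simp [act, ActSpace.one_apply]
  · rintro g h ⟨⟨p, hp⟩, z⟩
    simp [act, α.2.2, β.2.2]
  · simp [transportAct, pr₁, act]
  · simp [transportAct, pr₂, act]
  · have := (φ.symm x).1.2 1
    rwa [ActSpace.one_apply, ActSpace.one_apply] at this
  · have := hφ (φ.symm x)
    simpa using this.symm

end

/-! ### Stable codes and the Rokhlin property -/

section

variable {G : Type} [Group G]

/-- A set of itineraries is stable if some colouring codes onto it locally constantly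
near some action. -/
def IsStableCode (X : Set (G → ℕ)) : Prop :=
  ∃ (α : ActSpace G) (c : C(Cantor, ℕ)), ∀ᶠ β in 𝓝 α, codes β c = X

/-- Merge the second component away from a set of pairs of itineraries. -/
def fstCode (X : Set (G → ℕ)) : Set (G → ℕ) :=
  (fun x g => (Nat.unpair (x g)).1) '' X

theorem fstCode_codes (α : ActSpace G) (c a : C(Cantor, ℕ)) :
    fstCode (codes α (pairColor c a)) = codes α c := by
  rw [fstCode, codes, codes, itineraries, itineraries, ← Set.range_comp]
  congr 1
  ext x g
  simp

/-- The actions for which the colouring `d`, if it codes onto `fstCode X`, can locally stably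
be refined to code onto `X`. -/
def extensionSet (d : C(Cantor, ℕ)) (X : Set (G → ℕ)) : Set (ActSpace G) :=
  {β | codes β d = fstCode X}ᶜ ∪ {β | ∃ b, ∀ᶠ γ in 𝓝 β, codes γ (pairColor d b) = X}

theorem isOpen_extensionSet (d : C(Cantor, ℕ)) (X : Set (G → ℕ)) :
    IsOpen (extensionSet d X) := by
  refine (isClosed_setOf_codes_eq d _).isOpen_compl.union ?_
  simp only [Set.ofPred_exists]
  exact isOpen_iUnion fun b => isOpen_setOfPred_eventually_nhds

theorem dense_extensionSet (d : C(Cantor, ℕ)) {X : Set (G → ℕ)} (hX : IsStableCode X) :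
    Dense (extensionSet d X) := by
  obtain ⟨α, c', hα⟩ := hX
  rw [dense_iff_inter_open]
  rintro V hV ⟨β, hβV⟩
  by_cases hβ : codes β d = fstCode X
  swap
  · exact ⟨β, hβV, Or.inl hβ⟩
  let fstMap : C(ℕ, ℕ) := ⟨fun n => (Nat.unpair n).1, continuous_of_discreteTopology⟩
  let sndMap : C(ℕ, ℕ) := ⟨fun n => (Nat.unpair n).2, continuous_of_discreteTopology⟩
  have hpair : pairColor (fstMap.comp c') (sndMap.comp c') = c' := by
    ext x
    simp [fstMap, sndMap]
  have hαX : codes α c' = X := hα.self_of_nhds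
  have hcd : codes α (fstMap.comp c') = codes β d := by
    rw [hβ, ← hαX, ← fstCode_codes α _ (sndMap.comp c'), hpair]
  obtain ⟨b, hb⟩ := exists_color_of_mem_nhds β (hV.mem_nhds hβV)
  obtain ⟨e, he⟩ := exists_color_of_mem_nhds α hα.eventually_nhds
  obtain ⟨γ, π₁, π₂, hπ₁, hπ₂, hγ₁, hγ₂, h12, hπb⟩ :=
    exists_joint_extension α β (fstMap.comp c') d (pairColor d b) hcd
  have hπb' : ∀ x, d (π₂ x) = d x ∧ b (π₂ x) = b x := fun x =>
    (pairColor_eq_iff _ _ _ _ _ _).1 (hπb x)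
  refine ⟨γ, hb γ ?_, Or.inr ⟨(sndMap.comp c').comp π₁, ?_⟩⟩
  · rw [← codes_comp hπ₂ hγ₂ b]
    congr 1
    ext x
    exact (hπb' x).2.symm
  · obtain ⟨ψ, hψ⟩ := exists_homeomorph_of_range_eq richlyColorable_cantor
      richlyColorable_cantor (pairColor c' e) ((pairColor c' e).comp π₁)
      (hπ₁.range_comp (pairColor c' e)).symm
    have hψ' : ∀ x, c' (π₁ (ψ x)) = c' x ∧ e (π₁ (ψ x)) = e x := fun x =>
      (pairColor_eq_iff _ _ _ _ _ _).1 (hψ x)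
    have hd : pairColor d ((sndMap.comp c').comp π₁) = c'.comp π₁ := by
      ext x
      have : d x = (Nat.unpair (c' (π₁ x))).1 := by
        rw [← (hπb' x).1, ← h12]
        rfl
      simp [this, sndMap]
    have hconj : ∀ᶠ δ in 𝓝 (conjAct ψ γ), codes δ c' = X := by
      refine he _ ?_
      rw [← codes_comp hπ₁ hγ₁ e, ← codes_conjAct ψ γ]
      congr 1
      ext x
      exact (hψ' x).2.symm
    rw [hd]
    filter_upwards [(continuous_conjAct ψ).continuousAt.eventually hconj] with δ hδ
    rw [← hδ, ← codes_conjAct ψ δ]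
    congr 1
    ext x
    exact (hψ' x).1

/-- If the codes of generic actions lie in a countable set, then the strong topological
Rokhlin property holds. -/
theorem hasSTRP_of_countable_codes [Countable G] {𝒮 : Set (Set (G → ℕ))} (h𝒮 : 𝒮.Countable)
    (hgen : ∀ᶠ α in residual (ActSpace G), ∀ c : C(Cantor, ℕ), codes α c ∈ 𝒮) :
    HasSTRP G := by
  have := countable_continuousMap_nat Cantor
  have := h𝒮.to_subtype
  have hstable : ∀ᶠ α in residual (ActSpace G), ∀ c : C(Cantor, ℕ), IsStableCode (codes α c) := by
    rw [eventually_countable_forall]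
    intro c
    obtain ⟨t, ht, htδ, htd⟩ := mem_residual.1 hgen
    have hdense := htδ.dense_iUnion_interior_of_closed htd
      (fun X : 𝒮 => isClosed_setOf_codes_eq c X.1)
      (fun α hα => Set.mem_iUnion.2 ⟨⟨_, ht hα c⟩, rfl⟩)
    refine Filter.mem_of_superset
      (residual_of_dense_open (isOpen_iUnion fun _ => isOpen_interior) hdense) ?_
    intro α hα
    obtain ⟨X, hX⟩ := Set.mem_iUnion.1 hα
    have hαX : codes α c = X.1 := interior_subset (s := {α | codes α c = X.1}) hX
    exact ⟨α, c, by rw [hαX]; exact mem_interior_iff_mem_nhds.1 hX⟩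
  have hext : ∀ᶠ α in residual (ActSpace G), ∀ (d : C(Cantor, ℕ)) (X : 𝒮),
      IsStableCode X.1 → α ∈ extensionSet d X.1 := by
    refine eventually_countable_forall.2 fun d => eventually_countable_forall.2 fun X => ?_
    by_cases hX : IsStableCode X.1
    · filter_upwards [residual_of_dense_open (isOpen_extensionSet d X.1)
        (dense_extensionSet d hX)] with α hα _ using hα
    · exact Filter.Eventually.of_forall fun _ h => absurd h hX
  have hall := hgen.and (hstable.and hext)
  have : Nonempty (ActSpace G) := ⟨⟨fun _ => ContinuousMap.id _, rfl, fun _ _ => rfl⟩⟩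
  obtain ⟨α₀, hα₀⟩ := (dense_of_mem_residual hall).nonempty
  refine ⟨α₀, Filter.mem_of_superset hall fun β hβ => ?_⟩
  have extend : ∀ α β : ActSpace G,
      ((∀ c : C(Cantor, ℕ), codes α c ∈ 𝒮) ∧ ∀ c : C(Cantor, ℕ), IsStableCode (codes α c)) →
      (∀ (d : C(Cantor, ℕ)) (X : 𝒮), IsStableCode X.1 → β ∈ extensionSet d X.1) →
      ∀ c d : C(Cantor, ℕ), codes α c = codes β d →
      ∀ a, ∃ b, codes α (pairColor c a) = codes β (pairColor d b) := by
    intro α β hα hβ c d hcd a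
    rcases hβ d ⟨_, hα.1 (pairColor c a)⟩ (hα.2 _) with h | ⟨b, hb⟩
    · exact absurd (by rw [fstCode_codes, hcd]; rfl) h
    · exact ⟨b, hb.self_of_nhds.symm⟩
  obtain ⟨φ, -, hφ⟩ := exists_homeomorph_of_back_and_forth
    (act := fun g => α₀.1 g) (act' := fun g => β.1 g)
    (fun g => (α₀.1 g).continuous) (fun g => (β.1 g).continuous)
    α₀.one_apply β.one_apply
    (extend α₀ β ⟨hα₀.1, hα₀.2.1⟩ hβ.2.2)
    (fun c d h b => by
      obtain ⟨a, ha⟩ := extend β α₀ ⟨hβ.1, hβ.2.1⟩ hα₀.2.2 d c h.symm b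
      exact ⟨a, ha.symm⟩)
    0 0 (by
      have : ∀ α : ActSpace G, codes α (0 : C(Cantor, ℕ)) = {0} := fun α =>
        Set.range_const (c := (0 : G → ℕ))
      exact (this α₀).trans (this β).symm)
  refine ⟨φ, fun g => ?_⟩
  ext1 y
  have := hφ g (φ.symm y)
  simpa using this.symm

end

/-! ### Countability of sofic subshifts -/

section

variable {G : Type} [Group G]

/-- The subshift of finite type with window `E` and allowed patterns `P`. -/
def sftOf {B : Type} (E : Finset G) (P : Set (E → B)) : Set (G → B) :=
  {x | ∀ g : G, (fun e : E => shift g x (e : G)) ∈ P}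

theorem isClosed_sftOf {m : ℕ} (E : Finset G) (P : Set (E → Fin m)) : IsClosed (sftOf E P) := by
  simp only [sftOf, Set.ofPred_forall]
  refine isClosed_iInter fun g => ?_
  have hcont : Continuous fun (x : G → Fin m) (e : E) => shift g x (e : G) :=
    continuous_pi fun e => continuous_apply (g⁻¹ * (e : G))
  exact (isClosed_discrete P).preimage hcont

/-- A subshift of finite type over a standard alphabet together with a continuous colouring. -/
abbrev SoficData (G : Type) [Group G] : Type :=
  Σ (m : ℕ) (E : Finset G) (P : Set (E → Fin m)), C(sftOf E P, ℕ)

instance [Countable G] : Countable (SoficData G) := by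
  have : ∀ (m : ℕ) (E : Finset G) (P : Set (E → Fin m)), Countable C(sftOf E P, ℕ) :=
    fun m E P => by
      have : CompactSpace (sftOf E P) :=
        isCompact_iff_compactSpace.1 (isClosed_sftOf E P).isCompact
      exact countable_continuousMap_nat _
  infer_instance

/-- The itineraries described by a subshift of finite type and a colouring of it. -/
def SoficData.itineraries (p : SoficData G) : Set (G → ℕ) :=
  {y | ∃ z ∈ sftOf p.2.1 p.2.2.1, ∃ w : G → sftOf p.2.1 p.2.2.1,
    (∀ g, (w g : G → Fin p.1) = shift g z) ∧ ∀ g, y g = p.2.2.2 (w g)}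

theorem IsSofic.exists_soficData {n : ℕ} {X : Set (G → Fin n)} (hX : IsSofic G (Fin n) X) :
    ∃ p : SoficData G, p.itineraries = (fun y g => ((y g⁻¹ : Fin n) : ℕ)) '' X := by
  obtain ⟨B, _, _, Z, ψ, hZ, ⟨E, P, hEP⟩, hψ, hψG, rfl⟩ := hX
  let ε : B ≃ Fin (Fintype.card B) := Fintype.equivFin B
  let P' : Set (E → Fin (Fintype.card B)) := {w | (fun e => ε.symm (w e)) ∈ P}
  have hmem : ∀ z : G → Fin (Fintype.card B), z ∈ sftOf E P' ↔ (fun g => ε.symm (z g)) ∈ Z :=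
    fun z => (hEP fun g => ε.symm (z g)).symm
  let k : C(sftOf E P', ℕ) := ⟨fun z => (ψ (fun g => ε.symm (z.1 g)) 1 : Fin n), by
    let _ : TopologicalSpace B := ⊥
    have : DiscreteTopology B := ⟨rfl⟩
    have hψ' : ContinuousOn ψ Z := hψ
    have h1 : Continuous fun z : sftOf E P' => ψ (fun g => ε.symm (z.1 g)) :=
      hψ'.comp_continuous
        (continuous_pi fun g => continuous_of_discreteTopology.comp
          ((continuous_apply g).comp continuous_subtype_val))
        fun z => (hmem z.1).1 z.2
    exact continuous_of_discreteTopology.comp ((continuous_apply 1).comp h1)⟩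
  have hk : ∀ (z : G → B) (_ : z ∈ Z) (g : G) (w : sftOf E P'),
      (fun h => ε.symm (w.1 h)) = shift g z → k w = (ψ z g⁻¹ : Fin n) := by
    intro z hz g w hw
    change ((ψ (fun h => ε.symm (w.1 h)) 1 : Fin n) : ℕ) = _
    rw [hw, hψG g z hz]
    simp [shift]
  refine ⟨⟨Fintype.card B, E, P', k⟩, Set.Subset.antisymm ?_ ?_⟩
  · rintro y ⟨z, hz, w, hw, hy⟩
    refine ⟨_, ⟨_, (hmem z).1 hz, rfl⟩, ?_⟩
    funext g
    refine ((hy g).trans (hk _ ((hmem z).1 hz) g (w g) ?_)).symm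
    rw [hw g]
    rfl
  · rintro _ ⟨_, ⟨z, hz, rfl⟩, rfl⟩
    have hz' : ∀ g, (fun h => ε (shift g z h)) ∈ sftOf E P' := fun g => by
      rw [hmem]
      simpa using hZ.2 g z hz
    refine ⟨fun h => ε (z h), ?_, fun g => ⟨_, hz' g⟩, fun g => rfl, fun g => ?_⟩
    · rw [hmem]
      simpa using hz
    · exact (hk z hz g ⟨_, hz' g⟩ (by simp)).symm

/-- If all symbolic factors of an action are sofic, then so are all its codes. -/
theorem codes_mem_range_itineraries {α : ActSpace G}
    (hα : ∀ (n : ℕ) (φ : Cantor → G → Fin (n + 2)), ContinuousIntoShift φ →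
      (∀ g z, φ (α.1 g z) = shift g (φ z)) → IsSubshift G (Fin (n + 2)) (φ '' Set.univ) →
      IsSofic G (Fin (n + 2)) (φ '' Set.univ)) (c : C(Cantor, ℕ)) :
    codes α c ∈ Set.range (SoficData.itineraries (G := G)) := by
  obtain ⟨n, hn⟩ := ((isCompact_range c.continuous).finite_of_discrete).bddAbove
  have hlt : ∀ x, c x < n + 2 := fun x => by
    have := hn ⟨x, rfl⟩
    omega
  let φ : Cantor → G → Fin (n + 2) := fun z h => ⟨c (α.1 h⁻¹ z), hlt _⟩
  have hcont : Continuous φ := continuous_pi fun h => by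
    have h1 : Continuous fun z => c (α.1 h⁻¹ z) := by fun_prop
    exact (continuous_of_discreteTopology (f := fun k : ℕ => Fin.ofNat (n + 2) k)).comp h1 |>.congr
      fun z => by ext; simp [Nat.mod_eq_of_lt (hlt _), φ]
  have hequiv : ∀ g z, φ (α.1 g z) = shift g (φ z) := fun g z => by
    funext h
    simp [φ, shift, α.2.2]
  have hsub : IsSubshift G (Fin (n + 2)) (φ '' Set.univ) := by
    refine ⟨(isCompact_univ.image hcont).isClosed, ?_⟩
    rintro g _ ⟨z, -, rfl⟩
    exact ⟨α.1 g z, trivial, hequiv g z⟩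
  obtain ⟨p, hp⟩ := (hα n φ hcont hequiv hsub).exists_soficData
  refine ⟨p, ?_⟩
  rw [hp, Set.image_univ, ← Set.range_comp]
  congr 1
  ext z g
  simp [φ]

end

/-- If a countable group `G` does not have the strong topological
Rokhlin property, then the set of actions on the Cantor space admitting a non-sofic
symbolic factor is non-meager in `Act_G(𝒞)`. -/
theorem nonsofic_factor_nonmeager_of_no_strp (G : Type) [Group G] [Countable G]
    (hstrp : ¬ HasSTRP G) :
    ¬ IsMeagre {α : ActSpace G |
      ∃ (A : Type) (_ : Fintype A) (_ : Nontrivial A) (φ : Cantor → (G → A)),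
        ContinuousIntoShift φ ∧
        (∀ (g : G) (z : Cantor), φ ((α.1 g) z) = shift g (φ z)) ∧
        IsSubshift G A (φ '' Set.univ) ∧
        ¬ IsSofic G A (φ '' Set.univ)} := by
  intro hmeagre
  refine hstrp (hasSTRP_of_countable_codes (Set.countable_range SoficData.itineraries) ?_)
  refine Filter.mem_of_superset hmeagre fun α hα c => codes_mem_range_itineraries ?_ c
  intro n φ hφ hequiv hsub
  by_contra hns
  exact hα ⟨Fin (n + 2), inferInstance, inferInstance, φ, hφ, hequiv, hsub, hns⟩
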